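/- Let $k$ be a field of prime characteristic $p$, with $H_n$ the $T$-space of $k_0\langle X\rangle$ generated by $x_1^p\cdots x_n^p$ and $S^{(p)}$ the full symmetrization. Then for every $m \geq 1$ and every $i$ with $1 \leq i \leq 2m-1$, $H_i\, S^{(p)}\, H_{2m-i} \subseteq H_1 + H_{m+1}$ (meaning the span of products $u\, s\, w$ with $u \in H_i$, $s$ a substitution instance of $S^{(p)}$, $w \in H_{2m-i}$ lies in $H_1 + H_{m+1}$). -/

import Mathlib

open scoped BigOperators

/-- The free non-unital associative algebra over `k` on countably many variables,
realized as the semigroup algebra of the free semigroup on `ℕ`. -/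
abbrev FA (k : Type*) [Field k] := MonoidAlgebra k (FreeSemigroup ℕ)

/-- The generator (variable) `x_i`. -/
noncomputable def Xg (k : Type*) [Field k] (i : ℕ) : FA k :=
  MonoidAlgebra.single (FreeSemigroup.of i) 1

/-- Product of a (nonempty) list in a non-unital semiring; `0` on the empty list. -/
def lprod {A : Type*} [NonUnitalSemiring A] : List A → A
  | [] => 0
  | [a] => a
  | a :: b :: l => a * lprod (b :: l)

/-- `n`-th power in a non-unital semiring (zero for `n = 0`). -/
def npow' {A : Type*} [NonUnitalSemiring A] (a : A) (n : ℕ) : A :=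
  lprod (List.replicate n a)

/-- The full multilinear symmetrization `S^{(d)}(y_1,…,y_d) = ∑_{σ ∈ Σ_d} y_{σ(1)} ⋯ y_{σ(d)}`. -/
def Ssym {A : Type*} [NonUnitalSemiring A] (d : ℕ) (y : Fin d → A) : A :=
  ∑ σ : Equiv.Perm (Fin d), lprod (List.ofFn (fun i => y (σ i)))

/-- A T-space: a subspace closed under all substitution endomorphisms
(non-unital algebra endomorphisms). -/
def IsTSpace (k : Type*) [Field k] (V : Submodule k (FA k)) : Prop :=
  ∀ (φ : FA k →ₙₐ[k] FA k), ∀ v ∈ V, φ v ∈ V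

/-- The T-space generated by a set `S`: the span of all substitution instances
of elements of `S`. -/
noncomputable def TSpan (k : Type*) [Field k] (S : Set (FA k)) : Submodule k (FA k) :=
  Submodule.span k {a | ∃ (φ : FA k →ₙₐ[k] FA k) (s : FA k), s ∈ S ∧ a = φ s}

/-- The set of products `u * v` with `u ∈ U`, `v ∈ V`. -/
def mulSet {k : Type*} [Field k] (U V : Submodule k (FA k)) : Set (FA k) :=
  {a | ∃ u ∈ U, ∃ v ∈ V, a = u * v}

/-- The T-spaces `S_n^{(d)}`: `S_1^{(d)}` is generated by `S^{(d)}(x_1,…,x_d)` and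
`S_{n+1}^{(d)} = (S_n^{(d)} S_1^{(d)})^S`. -/
noncomputable def Sn (k : Type*) [Field k] (d : ℕ) : ℕ → Submodule k (FA k)
  | 0 => ⊥
  | 1 => TSpan k {Ssym d (fun i => Xg k i)}
  | (n+2) => TSpan k (mulSet (Sn k d (n+1)) (Sn k d 1))

/-- The T-spaces `H_n`: `H_1` is generated by `x_1^p` and `H_{n+1} = (H_n H_1)^S`. -/
noncomputable def Hn (k : Type*) [Field k] (p : ℕ) : ℕ → Submodule k (FA k)
  | 0 => ⊥
  | 1 => TSpan k {npow' (Xg k 0) p}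
  | (n+2) => TSpan k (mulSet (Hn k p (n+1)) (Hn k p 1))

/-- The word `x_1^p x_2^p ⋯ x_n^p`. -/
noncomputable def hword (k : Type*) [Field k] (p n : ℕ) : FA k :=
  lprod ((List.range n).map (fun t => npow' (Xg k t) p))

section Insertion

variable {R : Type*} [Ring R]

/-- The linearization `∑_{i+j=n-1} x^i v x^j` of the `n`-th power. -/
def insPow (x v : R) : ℕ → R
  | 0 => 0
  | n + 1 => insPow x v n * x + x ^ n * v

/-- The second linearization of the power map: the sum of all words containing `u` once,
`v` once, and `x` exactly `n - 2` times. -/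
def insPowTwo (x u v : R) : ℕ → R
  | 0 => 0
  | n + 1 => insPowTwo x u v n * x + insPow x u n * v + insPow x v n * u

theorem insPowTwo_comm (x u v : R) (n : ℕ) : insPowTwo x u v n = insPowTwo x v u n := by
  induction n with
  | zero => rfl
  | succ n ih => simp only [insPowTwo, ih]; abel

theorem insPow_add (x u v : R) (n : ℕ) :
    insPow x (u + v) n = insPow x u n + insPow x v n := by
  induction n with
  | zero => simp [insPow]
  | succ n ih => simp only [insPow, ih]; noncomm_ring

theorem insPow_zero_right (x : R) (n : ℕ) : insPow x 0 n = 0 := by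
  induction n with
  | zero => simp [insPow]
  | succ n ih => simp [insPow, ih]

theorem insPow_sum {ι : Type*} (s : Finset ι) (x : R) (f : ι → R) (n : ℕ) :
    insPow x (∑ i ∈ s, f i) n = ∑ i ∈ s, insPow x (f i) n := by
  classical
  induction s using Finset.induction_on with
  | empty => simp [insPow_zero_right]
  | insert a s ha ih => rw [Finset.sum_insert ha, Finset.sum_insert ha, insPow_add, ih]

theorem insPow_smul {k : Type*} [CommSemiring k] [Algebra k R] (c : k) (x v : R) (n : ℕ) :
    insPow x (c • v) n = c • insPow x v n := by
  induction n with
  | zero => simp [insPow]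
  | succ n ih => simp [insPow, ih, smul_add]

theorem insPow_self (x : R) (n : ℕ) : insPow x x n = n * x ^ n := by
  induction n with
  | zero => simp [insPow]
  | succ n ih => rw [insPow, ih, pow_succ]; push_cast; noncomm_ring

theorem insPow_mul_left (x v : R) (n : ℕ) : insPow x (x * v) n = x * insPow x v n := by
  induction n with
  | zero => simp [insPow]
  | succ n ih => rw [insPow, insPow, ih, mul_add, ← mul_assoc, ← mul_assoc, ← mul_assoc,
      ← pow_succ, ← pow_succ']

theorem insPow_pow_mul_left (x v : R) (m n : ℕ) :
    insPow x (x ^ m * v) n = x ^ m * insPow x v n := by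
  induction m with
  | zero => simp
  | succ m ih => rw [pow_succ', mul_assoc, insPow_mul_left, ih, mul_assoc]

theorem insPow_mul_of_commute (x v c : R) (hc : Commute x c) (n : ℕ) :
    insPow x (v * c) n = insPow x v n * c := by
  induction n with
  | zero => simp [insPow]
  | succ n ih => rw [insPow, insPow, ih, add_mul, mul_assoc _ c x, ← hc.eq]; noncomm_ring

theorem insPow_commutator (x v : R) (n : ℕ) :
    x ^ n * v - v * x ^ n = insPow x (x * v) n - insPow x (v * x) n := by
  rw [insPow_mul_left, insPow_mul_of_commute x v x (Commute.refl x)]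
  induction n with
  | zero => simp [insPow]
  | succ n ih =>
    have h : x * insPow x v n * x = insPow x v n * x * x + (x ^ n * v - v * x ^ n) * x := by
      rw [ih]; noncomm_ring
    rw [insPow, mul_add, ← mul_assoc, h, pow_succ']
    have e : x * x ^ n = x ^ n * x := (pow_succ' x n).symm.trans (pow_succ x n)
    simp only [add_mul, sub_mul, ← mul_assoc, e]
    abel

theorem insPowTwo_mul_add (x w v : R) (n : ℕ) :
    insPowTwo x w v n * x + insPow x w n * v =
      insPowTwo x (w * x) v n + insPow x (w * v) n := by
  induction n with
  | zero => simp [insPow, insPowTwo]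
  | succ n ih =>
    have h := congrArg (· * x) ih
    simp only [add_mul] at h
    have e := insPow_mul_of_commute x w x (Commute.refl x) n
    simp only [insPow, insPowTwo, add_mul, e]
    rw [h]
    simp only [← mul_assoc]
    abel

theorem insPow_mul_sub_insPow_mul (x v w : R) (n : ℕ) :
    insPow x v n * w - insPow x w n * v =
      (insPowTwo x (v * x) w n + insPow x (v * w) n) -
        (insPowTwo x (w * x) v n + insPow x (w * v) n) := by
  rw [← insPowTwo_mul_add, ← insPowTwo_mul_add, insPowTwo_comm x v w]
  abel

theorem map_insPow {R' : Type*} [Ring R'] (f : R →+* R') (x v : R) (n : ℕ) :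
    f (insPow x v n) = insPow (f x) (f v) n := by
  induction n with
  | zero => simp [insPow]
  | succ n ih => simp [insPow, ih]

end Insertion

section PolynomialInsertion

open Polynomial

variable {R : Type*} [Ring R]

/-- The polynomial line `a + b X`. -/
noncomputable def polyLine (a b : R) : R[X] := C a + C b * X

theorem natDegree_polyLine_le (a b : R) : (polyLine a b).natDegree ≤ 1 := by
  unfold polyLine; compute_degree

theorem coeff_polyLine_zero (a b : R) : (polyLine a b).coeff 0 = a := by simp [polyLine]

theorem coeff_polyLine_one (a b : R) : (polyLine a b).coeff 1 = b := by simp [polyLine]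

theorem derivative_polyLine (a b : R) : derivative (polyLine a b) = C b := by simp [polyLine]

theorem derivative_pow_eq_insPow (q : R[X]) (n : ℕ) :
    derivative (q ^ n) = insPow q (derivative q) n := by
  induction n with
  | zero => simp [insPow]
  | succ n ih => rw [pow_succ, derivative_mul, ih, insPow]

theorem coeff_zero_pow (q : R[X]) (n : ℕ) : (q ^ n).coeff 0 = q.coeff 0 ^ n := by
  induction n with
  | zero => simp
  | succ n ih => rw [pow_succ, mul_coeff_zero, ih, pow_succ]

theorem coeff_zero_insPow (q r : R[X]) (n : ℕ) :
    (insPow q r n).coeff 0 = insPow (q.coeff 0) (r.coeff 0) n := by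
  induction n with
  | zero => simp [insPow]
  | succ n ih => simp [insPow, mul_coeff_zero, ih, coeff_zero_pow]

theorem coeff_one_polyLine_pow (a b : R) (n : ℕ) :
    ((polyLine a b) ^ n).coeff 1 = insPow a b n := by
  induction n with
  | zero => simp [insPow, coeff_one]
  | succ n ih =>
    rw [pow_succ, mul_coeff_one, ih, coeff_zero_pow, coeff_polyLine_zero, coeff_polyLine_one,
      insPow, add_comm]

theorem coeff_one_insPow_polyLine (a b v : R) (n : ℕ) :
    (insPow (polyLine a b) (C v) n).coeff 1 = insPowTwo a b v n := by
  induction n with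
  | zero => simp [insPow, insPowTwo]
  | succ n ih =>
    simp only [insPow, insPowTwo, coeff_add, mul_coeff_one, ih, coeff_zero_insPow,
      coeff_polyLine_zero, coeff_polyLine_one, coeff_one_polyLine_pow, coeff_C_zero]
    simp
    abel

theorem natDegree_polyLine_pow_le (a b : R) (n : ℕ) : ((polyLine a b) ^ n).natDegree ≤ n := by
  simpa using natDegree_pow_le_of_le n (natDegree_polyLine_le a b)

theorem natDegree_insPow_polyLine_le (a b v : R) (n : ℕ) :
    (insPow (polyLine a b) (C v) (n + 1)).natDegree ≤ n := by
  induction n with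
  | zero => simp [insPow]
  | succ n ih =>
    rw [insPow]
    refine natDegree_add_le_of_degree_le ?_ ?_
    · exact natDegree_mul_le_of_le ih (natDegree_polyLine_le a b)
    · simpa using natDegree_mul_le_of_le (natDegree_polyLine_pow_le a b (n + 1))
        (natDegree_C v).le

theorem coeff_top_polyLine_pow (a b : R) (n : ℕ) : ((polyLine a b) ^ n).coeff n = b ^ n := by
  simpa [coeff_polyLine_one] using
    coeff_pow_of_natDegree_le (m := n) (natDegree_polyLine_le a b)

theorem coeff_top_insPow_polyLine (a b v : R) (n : ℕ) :
    (insPow (polyLine a b) (C v) (n + 1)).coeff n = insPow b v (n + 1) := by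
  induction n with
  | zero => simp [insPow]
  | succ n ih =>
    rw [insPow, coeff_add, coeff_mul_add_eq_of_natDegree_le
      (natDegree_insPow_polyLine_le a b v n) (natDegree_polyLine_le a b), ih, coeff_mul_C,
      coeff_top_polyLine_pow, coeff_polyLine_one]
    simp only [insPow]

end PolynomialInsertion

section Extraction

open Polynomial

variable {k U : Type*} [Field k] [Ring U] [Algebra k U]

/-- Evaluation of a polynomial over a noncommutative algebra at a scalar. -/
noncomputable def evalScalar (c : k) : U[X] →+* U :=
  eval₂RingHom' (RingHom.id U) (algebraMap k U c) fun a => (Algebra.commutes c a).symm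

theorem evalScalar_C (c : k) (a : U) : evalScalar c (C a) = a := by
  exact eval₂_C _ _

theorem evalScalar_X (c : k) : evalScalar c (X : U[X]) = algebraMap k U c := by
  exact eval₂_X _ _

theorem evalScalar_polyLine (c : k) (a b : U) : evalScalar c (polyLine a b) = a + c • b := by
  rw [polyLine, map_add, map_mul, evalScalar_C, evalScalar_C, evalScalar_X, ← Algebra.commutes,
    Algebra.smul_def]

theorem evalScalar_eq_sum {n : ℕ} {q : U[X]} (hq : ∀ i, n ≤ i → q.coeff i = 0) (c : k) :
    evalScalar c q = ∑ i ∈ Finset.range n, c ^ i • q.coeff i := by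
  rcases Nat.eq_zero_or_pos n with rfl | hn
  · have : q = 0 := by ext i; simpa using hq i (Nat.zero_le _)
    simp [this]
  have hd : q.natDegree < n := by
    by_contra h
    have h0 : q.natDegree ≠ 0 := by omega
    have := hq _ (not_lt.mp h)
    rw [coeff_natDegree, leadingCoeff_eq_zero] at this
    simp [this] at h0
  change eval₂ _ _ q = _
  rw [eval₂_eq_sum_range' _ hd]
  refine Finset.sum_congr rfl fun i _ => ?_
  rw [RingHom.id_apply, ← map_pow, Algebra.smul_def, Algebra.commutes]

theorem ZMod.sum_pow_eq {p : ℕ} [Fact p.Prime] (e : ℕ) :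
    ∑ μ : ZMod p, μ ^ e = if e ≠ 0 ∧ p - 1 ∣ e then -1 else 0 := by
  classical
  rcases eq_or_ne e 0 with rfl | he
  · simp
  have h := FiniteField.sum_pow_units (K := ZMod p) e
  rw [ZMod.card] at h
  rw [← Finset.sum_subset (Finset.subset_univ
    (Finset.univ.image (Units.val : (ZMod p)ˣ → ZMod p))), Finset.sum_image]
  · simp [he, h]
  · intro a _ b _ hab
    exact Units.ext hab
  · intro x _ hx
    have : x = 0 := by
      by_contra h0
      exact hx (Finset.mem_image.mpr ⟨Units.mk0 x h0, Finset.mem_univ _, rfl⟩)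
    simp [this, he]

variable {p : ℕ} [Fact p.Prime] (φ : ZMod p →+* k)

theorem sum_smul_evalScalar {q : U[X]} (hq : ∀ i, p ≤ i → q.coeff i = 0) {j : ℕ} (hj : 1 ≤ j)
    (hjp : j < p) :
    ∑ μ : ZMod p, φ μ ^ (p - 1 - j) • evalScalar (φ μ) q = -q.coeff j := by
  have key : ∀ i ∈ Finset.range p,
      (∑ μ : ZMod p, φ μ ^ (p - 1 - j + i)) • q.coeff i = if i = j then -q.coeff j else 0 := by
    intro i hi
    rw [Finset.mem_range] at hi
    have : ∑ μ : ZMod p, φ μ ^ (p - 1 - j + i) = φ (∑ μ : ZMod p, μ ^ (p - 1 - j + i)) := by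
      simp
    rw [this, ZMod.sum_pow_eq]
    split_ifs with h1 h2 h2
    · subst h2; simp
    · exfalso
      obtain ⟨h0, c, hc⟩ := h1
      have : c = 1 := by
        rcases c with _ | _ | c
        · omega
        · rfl
        · exfalso
          have : (p - 1) * 2 ≤ (p - 1) * (c + 1 + 1) := Nat.mul_le_mul_left _ (by omega)
          omega
      subst this
      omega
    · subst h2
      exact absurd ⟨by omega, by rw [show p - 1 - i + i = p - 1 by omega]⟩ h1
    · simp
  simp_rw [evalScalar_eq_sum hq, Finset.smul_sum, smul_smul, ← pow_add]
  rw [Finset.sum_comm]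
  simp_rw [← Finset.sum_smul]
  rw [Finset.sum_congr rfl key]
  simp [hjp]

/-- Coefficients of a polynomial of degree less than `p` are linear combinations of its values
at the elements of the prime field. -/
theorem coeff_mem_of_evalScalar_mem {q : U[X]} (hq : ∀ i, p ≤ i → q.coeff i = 0)
    (M : Submodule k U) (hM : ∀ μ : ZMod p, evalScalar (φ μ) q ∈ M) (j : ℕ) :
    q.coeff j ∈ M := by
  have hp : 0 < p := (Fact.out : p.Prime).pos
  rcases Nat.eq_zero_or_pos j with rfl | hj
  · have h := hM 0
    rw [evalScalar_eq_sum hq, map_zero, Finset.sum_eq_single_of_mem 0 (by simpa using hp)] at h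
    · simpa using h
    · intro i _ hi
      simp [hi]
  by_cases hjp : j < p
  · rw [← neg_neg (q.coeff j), ← sum_smul_evalScalar φ hq hj hjp]
    exact M.neg_mem (M.sum_mem fun μ _ => M.smul_mem _ (hM μ))
  · rw [hq j (not_lt.mp hjp)]
    exact M.zero_mem

end Extraction

section PowerSpans

open Polynomial

variable {k U : Type*} [Field k] [Ring U] [Algebra k U]

/-- The span of the `p`-th powers of elements of `A`. -/
def powSpan (A : NonUnitalSubalgebra k U) (p : ℕ) : Submodule k U :=
  Submodule.span k {z | ∃ a ∈ A, z = a ^ p}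

/-- The span of the linearized `p`-th powers of elements of `A`. -/
def linSpan (A : NonUnitalSubalgebra k U) (p : ℕ) : Submodule k U :=
  Submodule.span k {z | ∃ x ∈ A, ∃ v ∈ A, z = insPow x v p}

variable {A : NonUnitalSubalgebra k U} {p : ℕ}

theorem pow_mem_powSpan {a : U} (ha : a ∈ A) : a ^ p ∈ powSpan A p :=
  Submodule.subset_span ⟨a, ha, rfl⟩

theorem insPow_mem_linSpan {x v : U} (hx : x ∈ A) (hv : v ∈ A) : insPow x v p ∈ linSpan A p :=
  Submodule.subset_span ⟨x, hx, v, hv, rfl⟩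

theorem insPow_coeff_zero_of_le [hp : Fact p.Prime] (a b v : U) (i : ℕ) (hi : p ≤ i) :
    (insPow (polyLine a b) (C v) p).coeff i = 0 := by
  obtain ⟨n, rfl⟩ : ∃ n, p = n + 1 := ⟨p - 1, by have := hp.out.pos; omega⟩
  exact coeff_eq_zero_of_natDegree_lt
    (lt_of_le_of_lt (natDegree_insPow_polyLine_le a b v n) hi)

theorem evalScalar_insPow (c : k) (a b v : U) (n : ℕ) :
    evalScalar c (insPow (polyLine a b) (C v) n) = insPow (a + c • b) v n := by
  rw [map_insPow, evalScalar_polyLine, evalScalar_C]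

theorem pow_mem_of_pos {a : U} (ha : a ∈ A) {n : ℕ} (hn : 0 < n) : a ^ n ∈ A := by
  induction n, hn using Nat.le_induction with
  | base => simpa using ha
  | succ n _ ih => rw [pow_succ]; exact A.mul_mem ih ha

theorem coeff_polyLine_pow_mem {a b : U} (ha : a ∈ A) (hb : b ∈ A) {n : ℕ} (hn : 0 < n)
    (i : ℕ) : ((polyLine a b) ^ n).coeff i ∈ A := by
  have hL : ∀ i, (polyLine a b).coeff i ∈ A := by
    intro i
    rcases i with _ | _ | i
    · rwa [coeff_polyLine_zero]
    · rwa [coeff_polyLine_one]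
    · rw [coeff_eq_zero_of_natDegree_lt (lt_of_le_of_lt (natDegree_polyLine_le a b) (by omega))]
      exact A.zero_mem
  induction n, hn using Nat.le_induction generalizing i with
  | base => simpa using hL i
  | succ n _ ih =>
    rw [pow_succ, coeff_mul]
    exact sum_mem fun x _ => A.mul_mem (ih _) (hL _)

theorem commutator_mem_linSpan {h u : U} (hh : h ∈ powSpan A p) (hu : u ∈ A) :
    h * u - u * h ∈ linSpan A p := by
  induction hh using Submodule.span_induction with
  | mem x hx =>
    obtain ⟨a, ha, rfl⟩ := hx
    rw [insPow_commutator]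
    exact sub_mem (insPow_mem_linSpan ha (A.mul_mem ha hu))
      (insPow_mem_linSpan ha (A.mul_mem hu ha))
  | zero => simp
  | add x y _ _ hx hy =>
    have : (x + y) * u - u * (x + y) = (x * u - u * x) + (y * u - u * y) := by noncomm_ring
    rw [this]; exact add_mem hx hy
  | smul c x _ hx =>
    rw [smul_mul_assoc, mul_smul_comm, ← smul_sub]; exact Submodule.smul_mem _ _ hx

variable [hp : Fact p.Prime]

theorem coeff_insPow_mem_linSpan (φ : ZMod p →+* k) {a b v : U} (ha : a ∈ A) (hb : b ∈ A)
    (hv : v ∈ A) (j : ℕ) :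
    (insPow (polyLine a b) (C v) p).coeff j ∈ linSpan A p := by
  refine coeff_mem_of_evalScalar_mem φ (insPow_coeff_zero_of_le a b v) _ (fun μ => ?_) j
  rw [evalScalar_insPow]
  exact insPow_mem_linSpan (A.add_mem ha (A.smul_mem _ hb)) hv

theorem insPowTwo_mem_linSpan (φ : ZMod p →+* k) {a b v : U} (ha : a ∈ A) (hb : b ∈ A)
    (hv : v ∈ A) : insPowTwo a b v p ∈ linSpan A p := by
  rw [← coeff_one_insPow_polyLine]
  exact coeff_insPow_mem_linSpan φ ha hb hv 1

theorem insPow_mul_sub_mem (φ : ZMod p →+* k) {x v w : U} (hx : x ∈ A) (hv : v ∈ A)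
    (hw : w ∈ A) : insPow x v p * w - insPow x w p * v ∈ linSpan A p := by
  rw [insPow_mul_sub_insPow_mul]
  exact sub_mem
    (add_mem (insPowTwo_mem_linSpan φ hx (A.mul_mem hv hx) hw)
      (insPow_mem_linSpan hx (A.mul_mem hv hw)))
    (add_mem (insPowTwo_mem_linSpan φ hx (A.mul_mem hw hx) hv)
      (insPow_mem_linSpan hx (A.mul_mem hw hv)))

theorem natCast_eq_zero_of_ringHom (φ : ZMod p →+* k) : (p : U) = 0 := by
  have h : (p : k) = 0 := by rw [← map_natCast φ p]; simp
  rw [← map_natCast (algebraMap k U) p, h, map_zero]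

theorem insPow_self_eq_zero (φ : ZMod p →+* k) (x : U) : insPow x x p = 0 := by
  rw [insPow_self, natCast_eq_zero_of_ringHom φ, zero_mul]

theorem linSpan_le_powSpan (φ : ZMod p →+* k) : linSpan A p ≤ powSpan A p := by
  refine Submodule.span_le.mpr ?_
  rintro _ ⟨x, hx, v, hv, rfl⟩
  have h2 := hp.out.two_le
  have hq : ∀ i, p ≤ i → ((polyLine x v) ^ p - C (v ^ p) * X ^ p).coeff i = 0 := by
    intro i hi
    rcases hi.eq_or_lt with rfl | hi
    · rw [coeff_sub, coeff_top_polyLine_pow, coeff_C_mul_X_pow, if_pos rfl, sub_self]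
    · rw [coeff_sub, coeff_eq_zero_of_natDegree_lt
        (lt_of_le_of_lt (natDegree_polyLine_pow_le x v p) hi), coeff_C_mul_X_pow,
        if_neg hi.ne', sub_zero]
  have h := coeff_mem_of_evalScalar_mem φ hq (powSpan A p) (fun μ => ?_) 1
  · rw [coeff_sub, coeff_one_polyLine_pow, coeff_C_mul_X_pow, if_neg (by omega), sub_zero] at h
    exact h
  · rw [map_sub, map_pow, evalScalar_polyLine, map_mul, evalScalar_C]
    have : evalScalar (φ μ) (X ^ p : U[X]) = algebraMap k U (φ μ ^ p) := by
      rw [map_pow, evalScalar_X, map_pow]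
    rw [this, ← Algebra.commutes, ← Algebra.smul_def]
    exact sub_mem (pow_mem_powSpan (A.add_mem hx (A.smul_mem _ hv)))
      (Submodule.smul_mem _ _ (pow_mem_powSpan hv))

theorem powSpan_le : powSpan A p ≤ A.toSubmodule := by
  refine Submodule.span_le.mpr ?_
  rintro _ ⟨a, ha, rfl⟩
  exact pow_mem_of_pos ha hp.out.pos

theorem coeff_insPow_mem_linSpan' (φ : ZMod p →+* k) {a b : U} (ha : a ∈ A) (hb : b ∈ A)
    {q : U[X]} (hq : ∀ i, q.coeff i ∈ A) (j : ℕ) :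
    (insPow (polyLine a b) q p).coeff j ∈ linSpan A p := by
  rw [q.as_sum_range_C_mul_X_pow, insPow_sum, finsetSum_coeff]
  refine sum_mem fun i _ => ?_
  rw [insPow_mul_of_commute _ _ _ (commute_X_pow _ i).symm, coeff_mul_X_pow']
  split_ifs
  · exact coeff_insPow_mem_linSpan φ ha hb (hq i) _
  · exact zero_mem _

/-- Comparing coefficients in `L^p P(L; v) = P(L; L^p v)`, for the line `L = a + x X`, expresses
`a^p P(x; v)` through products of two linearized powers. -/
theorem sum_coeff_mul_coeff_mem (φ : ZMod p →+* k) {a x v : U} (ha : a ∈ A) (hx : x ∈ A)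
    (hv : v ∈ A) :
    a ^ p * insPow x v p + ∑ i ∈ Finset.Ico 1 p, ((polyLine a x) ^ p).coeff i *
      (insPow (polyLine a x) (C v) p).coeff (p - 1 - i) ∈ linSpan A p := by
  have hp0 := hp.out.pos
  have h := coeff_insPow_mem_linSpan' φ ha hx (q := (polyLine a x) ^ p * C v)
    (fun i => by rw [coeff_mul_C]; exact A.mul_mem (coeff_polyLine_pow_mem ha hx hp0 i) hv) (p - 1)
  rw [insPow_pow_mul_left, coeff_mul, Finset.Nat.sum_antidiagonal_eq_sum_range_succ_mk,
    show (p - 1).succ = p by omega, Finset.range_eq_Ico, Finset.sum_eq_sum_Ico_succ_bot hp0] at h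
  have ht := coeff_top_insPow_polyLine a x v (p - 1)
  rw [show p - 1 + 1 = p by omega] at ht
  simpa [coeff_zero_pow, coeff_polyLine_zero, ht] using h

end PowerSpans

section Reduction

open Polynomial

variable {k U : Type*} [Field k] [Ring U] [Algebra k U]
variable {A : NonUnitalSubalgebra k U} {p : ℕ}

variable (A p) in
/-- The subspace `H + S H^{n+1}`, where `H` is the span of `p`-th powers and `S` the span of
linearized `p`-th powers. -/
def redSpan (n : ℕ) : Submodule k U := powSpan A p ⊔ linSpan A p * powSpan A p ^ (n + 1)

theorem mul_mul_mem_redSpan {s h d : U} {n : ℕ} (hs : s ∈ linSpan A p) (hh : h ∈ powSpan A p)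
    (hd : d ∈ powSpan A p ^ n) : s * h * d ∈ redSpan A p n := by
  refine Submodule.mem_sup_right ?_
  rw [pow_succ', mul_assoc]
  exact Submodule.mul_mem_mul hs (Submodule.mul_mem_mul hh hd)

theorem mul_mul_mem_redSpan' {s h d : U} {n : ℕ} (hs : s ∈ linSpan A p)
    (hd : d ∈ powSpan A p ^ n) (hh : h ∈ powSpan A p) : s * d * h ∈ redSpan A p n := by
  refine Submodule.mem_sup_right ?_
  rw [pow_succ, mul_assoc]
  exact Submodule.mul_mem_mul hs (Submodule.mul_mem_mul hd hh)

variable [hp : Fact p.Prime]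

theorem mul_powSpan_pow_mem {w d : U} {n : ℕ} (hw : w ∈ A) (hd : d ∈ powSpan A p ^ n) :
    w * d ∈ A := by
  induction n generalizing d with
  | zero =>
    obtain ⟨c, rfl⟩ := Submodule.mem_one.mp (by simpa using hd)
    rw [← Algebra.commutes, ← Algebra.smul_def]
    exact A.smul_mem _ hw
  | succ n ih =>
    rw [pow_succ] at hd
    induction hd using Submodule.mul_induction_on' with
    | mem_mul_mem e he h hh =>
      rw [← mul_assoc]
      exact A.mul_mem (ih he) (powSpan_le hh)
    | add x _ y _ hx hy => rw [mul_add]; exact A.add_mem hx hy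

theorem commutator_mem_powSpan_pow (φ : ZMod p →+* k) {w d : U} {n : ℕ}
    (hd : d ∈ powSpan A p ^ n) (hw : w ∈ A) : d * w - w * d ∈ powSpan A p ^ n := by
  induction n generalizing d with
  | zero =>
    obtain ⟨c, rfl⟩ := Submodule.mem_one.mp (by simpa using hd)
    rw [Algebra.commutes, sub_self]
    exact zero_mem _
  | succ n ih =>
    rw [pow_succ] at hd ⊢
    induction hd using Submodule.mul_induction_on' with
    | mem_mul_mem e he h hh =>
      have : e * h * w - w * (e * h) = e * (h * w - w * h) + (e * w - w * e) * h := by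
        noncomm_ring
      rw [this]
      exact add_mem
        (Submodule.mul_mem_mul he (linSpan_le_powSpan φ (commutator_mem_linSpan hh hw)))
        (Submodule.mul_mem_mul (ih he) hh)
    | add x _ y _ hx hy =>
      have : (x + y) * w - w * (x + y) = (x * w - w * x) + (y * w - w * y) := by noncomm_ring
      rw [this]
      exact add_mem hx hy

theorem powSpan_pow_commutator_mem_linSpan {w d : U} {n : ℕ}
    (hd : d ∈ powSpan A p ^ n) (hw : w ∈ A) : d * w - w * d ∈ linSpan A p := by
  induction n generalizing d w with
  | zero =>
    obtain ⟨c, rfl⟩ := Submodule.mem_one.mp (by simpa using hd)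
    rw [Algebra.commutes, sub_self]
    exact zero_mem _
  | succ n ih =>
    rw [pow_succ] at hd
    induction hd using Submodule.mul_induction_on' with
    | mem_mul_mem e he h hh =>
      have : e * h * w - w * (e * h) =
          (e * (h * w) - h * w * e) + (h * (w * e) - w * e * h) := by
        noncomm_ring
      rw [this]
      exact add_mem (ih he (A.mul_mem (powSpan_le hh) hw))
        (commutator_mem_linSpan hh (mul_powSpan_pow_mem hw he))
    | add x _ y _ hx hy =>
      have : (x + y) * w - w * (x + y) = (x * w - w * x) + (y * w - w * y) := by noncomm_ring
      rw [this]
      exact add_mem hx hy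

theorem linSpan_mem_redSpan (φ : ZMod p →+* k) {s : U} (n : ℕ) (hs : s ∈ linSpan A p) :
    s ∈ redSpan A p n :=
  Submodule.mem_sup_left (linSpan_le_powSpan φ hs)

theorem linSpan_le (φ : ZMod p →+* k) : linSpan A p ≤ A.toSubmodule :=
  (linSpan_le_powSpan φ).trans powSpan_le

variable {n : ℕ} {d : U}

theorem mul_insPow_swap (φ : ZMod p →+* k) (hd : d ∈ powSpan A p ^ n) {s z u w : U}
    (hs : s ∈ linSpan A p) (hz : z ∈ A) (hu : u ∈ A) (hw : w ∈ A) :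
    s * insPow z u p * w * d - s * insPow z w p * u * d ∈ redSpan A p n := by
  have := mul_mul_mem_redSpan hs
    (linSpan_le_powSpan φ (insPow_mul_sub_mem φ hz hu hw)) hd
  convert this using 1
  noncomm_ring

theorem mul_mul_flip (φ : ZMod p →+* k) (hd : d ∈ powSpan A p ^ n) {s t w : U}
    (hs : s ∈ linSpan A p) (ht : t ∈ linSpan A p) (hw : w ∈ A) :
    s * t * w * d - t * d * s * w ∈ redSpan A p n := by
  have hsH := linSpan_le_powSpan φ hs
  have h1 := linSpan_mem_redSpan φ n (commutator_mem_linSpan hsH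
    (mul_powSpan_pow_mem (A.mul_mem (linSpan_le φ ht) hw) hd))
  have h2 := mul_mul_mem_redSpan' ht (commutator_mem_powSpan_pow φ hd hw) hsH
  have h3 := mul_mul_mem_redSpan' ht hd
    (linSpan_le_powSpan φ (commutator_mem_linSpan hsH hw))
  convert sub_mem (sub_mem h1 h2) h3 using 1
  noncomm_ring

theorem insPow_mul_swap (φ : ZMod p →+* k) (hd : d ∈ powSpan A p ^ n) {y v t w : U}
    (hy : y ∈ A) (hv : v ∈ A) (ht : t ∈ linSpan A p) (hw : w ∈ A) :
    insPow y v p * t * w * d - insPow y w p * t * v * d ∈ redSpan A p n := by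
  have h1 := mul_mul_flip φ hd (insPow_mem_linSpan hy hv) ht hw
  have h2 := mul_mul_flip φ hd (insPow_mem_linSpan hy hw) ht hv
  have h3 := mul_mul_mem_redSpan' ht hd
    (linSpan_le_powSpan φ (insPow_mul_sub_mem φ hy hv hw))
  convert add_mem (sub_mem h1 h2) h3 using 1
  noncomm_ring

theorem insPow_mul_insPow_swap (φ : ZMod p →+* k) (hd : d ∈ powSpan A p ^ n) {y v z u w : U}
    (hy : y ∈ A) (hv : v ∈ A) (hz : z ∈ A) (hu : u ∈ A) (hw : w ∈ A) :
    insPow y v p * insPow z u p * w * d - insPow y u p * insPow z v p * w * d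
      ∈ redSpan A p n := by
  have h1 := insPow_mul_swap φ hd hy hv (insPow_mem_linSpan hz hu) hw
  have h2 := mul_insPow_swap φ hd (insPow_mem_linSpan hy hw) hz hu hv
  have h3 := insPow_mul_swap φ hd hy hw (insPow_mem_linSpan hz hv) hu
  convert add_mem (add_mem h1 h2) h3 using 1
  noncomm_ring

theorem insPow_mul_insPow_self_mem (φ : ZMod p →+* k) (hd : d ∈ powSpan A p ^ n)
    {y v z w : U} (hy : y ∈ A) (hv : v ∈ A) (hz : z ∈ A) (hw : w ∈ A) :
    insPow y z p * insPow z v p * w * d ∈ redSpan A p n := by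
  simpa [insPow_self_eq_zero φ] using insPow_mul_insPow_swap φ hd hy hz hz hv hw

theorem insPow_mul_insPow_line_mem_of_ne (φ : ZMod p →+* k) (hd : d ∈ powSpan A p ^ n)
    {y x v w : U} (hy : y ∈ A) (hx : x ∈ A) (hv : v ∈ A) (hw : w ∈ A) {c : k} (hc : c ≠ 0) :
    insPow y x p * insPow (y + c • x) v p * w * d ∈ redSpan A p n := by
  have h := insPow_mul_insPow_self_mem φ hd hy hv (A.add_mem hy (A.smul_mem c hx)) hw
  rw [insPow_add, insPow_smul, insPow_self_eq_zero φ, zero_add] at h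
  simp only [smul_mul_assoc] at h
  exact (Submodule.smul_mem_iff _ hc).mp h

theorem insPow_mul_insPow_same_mem (φ : ZMod p →+* k) (hd : d ∈ powSpan A p ^ n)
    {y x v w : U} (hy : y ∈ A) (hx : x ∈ A) (hv : v ∈ A) (hw : w ∈ A) :
    insPow y x p * insPow y v p * w * d ∈ redSpan A p n := by
  classical
  have h2 := hp.out.two_le
  have h := sum_smul_evalScalar φ (insPow_coeff_zero_of_le (p := p) y x v) (j := p - 1)
    (by omega) (by omega)
  have ht := coeff_top_insPow_polyLine y x v (p - 1)
  rw [show p - 1 + 1 = p by omega] at ht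
  simp only [ht, Nat.sub_self, pow_zero, one_smul, evalScalar_insPow] at h
  rw [← Finset.add_sum_erase _ _ (Finset.mem_univ 0), map_zero, zero_smul, add_zero,
    ← eq_sub_iff_add_eq] at h
  rw [h, mul_sub, sub_mul, sub_mul, mul_neg, neg_mul, neg_mul, Finset.mul_sum,
    Finset.sum_mul, Finset.sum_mul]
  refine sub_mem (neg_mem (insPow_mul_insPow_self_mem φ hd hy hv hx hw))
    (sum_mem fun ν hν => insPow_mul_insPow_line_mem_of_ne φ hd hy hx hv hw ?_)
  exact (_root_.map_ne_zero φ).mpr (Finset.ne_of_mem_erase hν)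

theorem insPow_mul_insPow_line_mem (φ : ZMod p →+* k) (hd : d ∈ powSpan A p ^ n)
    {y x v w : U} (hy : y ∈ A) (hx : x ∈ A) (hv : v ∈ A) (hw : w ∈ A) (c : k) :
    insPow y x p * insPow (y + c • x) v p * w * d ∈ redSpan A p n := by
  rcases eq_or_ne c 0 with rfl | hc
  · rw [zero_smul, add_zero]
    exact insPow_mul_insPow_same_mem φ hd hy hx hv hw
  · exact insPow_mul_insPow_line_mem_of_ne φ hd hy hx hv hw hc

theorem coeff_insPow_mul_coeff_insPow_mem (φ : ZMod p →+* k) (hd : d ∈ powSpan A p ^ n)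
    {a x v w : U} (ha : a ∈ A) (hx : x ∈ A) (hv : v ∈ A) (hw : w ∈ A) (i j : ℕ) :
    (insPow (polyLine a x) (C x) p).coeff i * (insPow (polyLine a x) (C v) p).coeff j * w * d
      ∈ redSpan A p n := by
  refine coeff_mem_of_evalScalar_mem φ (insPow_coeff_zero_of_le a x x)
    ((redSpan A p n).comap (LinearMap.mulRight k d ∘ₗ LinearMap.mulRight k w ∘ₗ
      LinearMap.mulRight k ((insPow (polyLine a x) (C v) p).coeff j))) (fun μ => ?_) i
  refine coeff_mem_of_evalScalar_mem φ (insPow_coeff_zero_of_le a x v)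
    ((redSpan A p n).comap (LinearMap.mulRight k d ∘ₗ LinearMap.mulRight k w ∘ₗ
      LinearMap.mulLeft k (evalScalar (φ μ) (insPow (polyLine a x) (C x) p)))) (fun ν => ?_) j
  have h := insPow_mul_insPow_line_mem φ hd (A.add_mem ha (A.smul_mem (φ μ) hx)) hx hv hw
    (φ ν - φ μ)
  rw [add_assoc, ← add_smul, add_sub_cancel] at h
  simpa [evalScalar_insPow] using h

theorem natCast_ne_zero_of_lt (φ : ZMod p →+* k) {i : ℕ} (hi : 0 < i) (hip : i < p) :
    (i : k) ≠ 0 := by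
  rw [← map_natCast φ, _root_.map_ne_zero, Ne, ZMod.natCast_eq_zero_iff]
  exact Nat.not_dvd_of_pos_of_lt hi hip

theorem coeff_polyLine_pow_eq (φ : ZMod p →+* k) (a x : U) {i : ℕ} (hi : 0 < i) (hip : i < p) :
    ((polyLine a x) ^ p).coeff i =
      (i : k)⁻¹ • (insPow (polyLine a x) (C x) p).coeff (i - 1) := by
  rw [eq_inv_smul_iff₀ (natCast_ne_zero_of_lt φ hi hip)]
  obtain ⟨i, rfl⟩ := Nat.exists_eq_add_of_lt hi
  rw [← derivative_polyLine a x, ← derivative_pow_eq_insPow, coeff_derivative, zero_add,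
    Nat.add_sub_cancel, Algebra.smul_def, map_natCast, Nat.cast_comm]
  push_cast
  rfl

theorem coeff_pow_mul_coeff_insPow_mem (φ : ZMod p →+* k) (hd : d ∈ powSpan A p ^ n)
    {a x v w : U} (ha : a ∈ A) (hx : x ∈ A) (hv : v ∈ A) (hw : w ∈ A) {i : ℕ} (hi : 0 < i)
    (hip : i < p) (j : ℕ) :
    ((polyLine a x) ^ p).coeff i * (insPow (polyLine a x) (C v) p).coeff j * w * d
      ∈ redSpan A p n := by
  rw [coeff_polyLine_pow_eq φ a x hi hip, smul_mul_assoc, smul_mul_assoc, smul_mul_assoc]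
  exact Submodule.smul_mem _ _ (coeff_insPow_mul_coeff_insPow_mem φ hd ha hx hv hw _ _)

theorem pow_mul_insPow_mul_mem (φ : ZMod p →+* k) (hd : d ∈ powSpan A p ^ n)
    {a x v h : U} (ha : a ∈ A) (hx : x ∈ A) (hv : v ∈ A) (hh : h ∈ powSpan A p) :
    a ^ p * insPow x v p * h * d ∈ redSpan A p n := by
  have h1 := mul_mul_mem_redSpan (sum_coeff_mul_coeff_mem φ ha hx hv) hh hd
  rw [add_mul, add_mul, Finset.sum_mul, Finset.sum_mul] at h1
  refine (Submodule.add_mem_iff_left _ (sum_mem fun i hi => ?_)).mp h1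
  rw [Finset.mem_Ico] at hi
  exact coeff_pow_mul_coeff_insPow_mem φ hd ha hx hv (powSpan_le hh) hi.1 hi.2 _

theorem insPow_mul_pow_mul_mem (φ : ZMod p →+* k) (hd : d ∈ powSpan A p ^ n)
    {a x v h : U} (ha : a ∈ A) (hx : x ∈ A) (hv : v ∈ A) (hh : h ∈ powSpan A p) :
    insPow x v p * a ^ p * h * d ∈ redSpan A p n := by
  have h1 := mul_mul_mem_redSpan (commutator_mem_linSpan (pow_mem_powSpan ha)
    (linSpan_le φ (insPow_mem_linSpan (p := p) hx hv))) hh hd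
  convert sub_mem (pow_mul_insPow_mul_mem φ hd ha hx hv hh) h1 using 1
  noncomm_ring

theorem linSpan_mul_powSpan_pow_le_redSpan (φ : ZMod p →+* k) (n : ℕ) :
    linSpan A p * powSpan A p ^ (n + 2) ≤ redSpan A p n := by
  rw [pow_succ', pow_succ', ← mul_assoc, ← mul_assoc, Submodule.mul_le]
  intro q hq d hd
  have key : linSpan A p * powSpan A p * powSpan A p ≤
      (redSpan A p n).comap (LinearMap.mulRight k d) := by
    rw [Submodule.mul_le]
    intro q hq h hh
    have key : linSpan A p * powSpan A p ≤
        (redSpan A p n).comap (LinearMap.mulRight k d ∘ₗ LinearMap.mulRight k h) := by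
      rw [linSpan, powSpan, Submodule.span_mul_span, Submodule.span_le]
      rintro _ ⟨_, ⟨x, hx, v, hv, rfl⟩, _, ⟨a, ha, rfl⟩, rfl⟩
      exact insPow_mul_pow_mul_mem φ hd ha hx hv hh
    exact key hq
  exact key hq

theorem linSpan_mul_powSpan_pow_le (φ : ZMod p →+* k) {m N : ℕ} (hm : 1 ≤ m) (hmN : m ≤ N) :
    linSpan A p * powSpan A p ^ N ≤ powSpan A p ⊔ linSpan A p * powSpan A p ^ m := by
  induction N, hmN using Nat.le_induction with
  | base => exact le_sup_right
  | succ N hN ih =>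
    obtain ⟨r, rfl⟩ : ∃ r, N = r + 1 := ⟨N - 1, by omega⟩
    exact (linSpan_mul_powSpan_pow_le_redSpan φ r).trans (sup_le le_sup_left ih)

/-- The product `H^i S H^j` is contained in `H + H^{m+1}` as soon as `m ≤ i + j`. -/
theorem mul_linSpan_mul_mem (φ : ZMod p →+* k) {m i j : ℕ} (hm : 1 ≤ m) (hij : m ≤ i + j)
    {u s w : U} (hu : u ∈ powSpan A p ^ i) (hs : s ∈ linSpan A p) (hw : w ∈ powSpan A p ^ j) :
    u * s * w ∈ powSpan A p ⊔ powSpan A p ^ (m + 1) := by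
  have h1 := Submodule.mem_sup_left (T := powSpan A p ^ (m + 1))
    (linSpan_le_powSpan φ (powSpan_pow_commutator_mem_linSpan hu
      (mul_powSpan_pow_mem (linSpan_le φ hs) hw)))
  have h2 : s * (w * u) ∈ powSpan A p ⊔ linSpan A p * powSpan A p ^ m := by
    refine linSpan_mul_powSpan_pow_le φ hm (N := j + i) (by omega) (Submodule.mul_mem_mul hs ?_)
    rw [pow_add]
    exact Submodule.mul_mem_mul hw hu
  have h3 : powSpan A p ⊔ linSpan A p * powSpan A p ^ m ≤
      powSpan A p ⊔ powSpan A p ^ (m + 1) := by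
    rw [pow_succ']
    exact sup_le_sup_left (mul_le_mul_left (linSpan_le_powSpan φ) _) _
  convert add_mem h1 (h3 h2) using 1
  noncomm_ring

end Reduction

section Symmetrization

open Polynomial

variable {k U : Type*} [Field k] [Ring U] [Algebra k U]
variable {A : NonUnitalSubalgebra k U} {p : ℕ}

theorem sum_pow_eq_sum_prod {ι : Type*} [Fintype ι] [DecidableEq ι] (T : Finset ι) (n : ℕ)
    (y : ι → U) :
    (∑ i ∈ T, y i) ^ n =
      ∑ r ∈ Fintype.piFinset fun _ : Fin n => T, (List.ofFn fun j => y (r j)).prod := by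
  simpa using (MultilinearMap.mkPiAlgebraFin ℤ n U).map_sum_finset
    (fun _ i => y i) (fun _ => T)

theorem sum_perm_prod_eq (n : ℕ) (y : Fin n → U) :
    ∑ σ : Equiv.Perm (Fin n), (List.ofFn fun i => y (σ i)).prod =
      ∑ t ∈ (Finset.univ : Finset (Fin n)).powerset,
        (-1 : ℤ) ^ t.card • (∑ i ∈ tᶜ, y i) ^ n := by
  classical
  have h := Finset.inclusion_exclusion_sum_inf_compl (Finset.univ : Finset (Fin n))
    (fun i => Fintype.piFinset fun _ : Fin n => ({i}ᶜ : Finset (Fin n)))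
    (fun r : Fin n → Fin n => (List.ofFn fun j => y (r j)).prod)
  have hinf : ∀ t : Finset (Fin n),
      (t.inf fun i => Fintype.piFinset fun _ : Fin n => ({i}ᶜ : Finset (Fin n))) =
        Fintype.piFinset fun _ : Fin n => tᶜ := by
    intro t
    ext r
    simp only [Finset.mem_inf, Fintype.mem_piFinset, Finset.mem_compl, Finset.mem_singleton]
    exact ⟨fun h j hj => h _ hj j rfl, fun h i hi j hj => h j (hj ▸ hi)⟩
  simp only [hinf, ← sum_pow_eq_sum_prod] at h
  rw [← h]
  refine Finset.sum_nbij (fun σ => ⇑σ) ?_ ?_ ?_ (fun _ _ => rfl)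
  · intro σ _
    simp only [Finset.mem_inf, Finset.mem_compl, Fintype.mem_piFinset, Finset.mem_singleton,
      not_forall, not_not]
    exact fun i _ => σ.surjective i
  · exact fun σ _ τ _ h => DFunLike.coe_injective h
  · intro r hr
    simp only [Finset.mem_coe, Finset.mem_inf, Finset.mem_compl, Fintype.mem_piFinset,
      Finset.mem_singleton, not_forall, not_not] at hr
    have hs : Function.Surjective r := fun i => hr i (Finset.mem_univ i)
    exact ⟨Equiv.ofBijective r ⟨Finite.injective_iff_surjective.mpr hs, hs⟩, by simp, rfl⟩

variable [hp : Fact p.Prime]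

theorem coeff_polyLine_pow_mem_linSpan (φ : ZMod p →+* k) {a x : U} (ha : a ∈ A) (hx : x ∈ A)
    {i : ℕ} (hi : 0 < i) (hip : i < p) : ((polyLine a x) ^ p).coeff i ∈ linSpan A p := by
  rw [coeff_polyLine_pow_eq φ a x hi hip]
  exact Submodule.smul_mem _ _ (coeff_insPow_mem_linSpan φ ha hx hx _)

theorem add_pow_sub_mem_linSpan (φ : ZMod p →+* k) {x y : U} (hx : x ∈ A) (hy : y ∈ A) :
    (x + y) ^ p - x ^ p - y ^ p ∈ linSpan A p := by
  have h : (x + y) ^ p = ∑ i ∈ Finset.range (p + 1), ((polyLine x y) ^ p).coeff i := by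
    have := evalScalar_eq_sum (n := p + 1) (q := (polyLine x y) ^ p) (fun i hi =>
      coeff_eq_zero_of_natDegree_lt (lt_of_le_of_lt (natDegree_polyLine_pow_le x y p) hi)) (1 : k)
    simpa [evalScalar_polyLine] using this
  rw [h, Finset.sum_range_succ, coeff_top_polyLine_pow, Finset.range_eq_Ico,
    Finset.sum_eq_sum_Ico_succ_bot hp.out.pos, coeff_zero_pow, coeff_polyLine_zero]
  have : ∑ i ∈ Finset.Ico (0 + 1) p, ((polyLine x y) ^ p).coeff i ∈ linSpan A p :=
    sum_mem fun i hi => by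
      rw [Finset.mem_Ico] at hi
      exact coeff_polyLine_pow_mem_linSpan φ hx hy hi.1 hi.2
  convert this using 1
  abel

theorem sum_pow_sub_mem_linSpan (φ : ZMod p →+* k) {ι : Type*} {y : ι → U}
    (hy : ∀ i, y i ∈ A) (T : Finset ι) :
    (∑ i ∈ T, y i) ^ p - ∑ i ∈ T, y i ^ p ∈ linSpan A p := by
  classical
  induction T using Finset.induction_on with
  | empty => simp [hp.out.ne_zero]
  | insert a T ha ih =>
    rw [Finset.sum_insert ha, Finset.sum_insert ha]
    convert add_mem (add_pow_sub_mem_linSpan φ (hy a) (A.sum_mem fun i (_ : i ∈ T) => hy i)) ih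
      using 1
    abel

/-- The full symmetrization of degree `p` is a combination of linearized `p`-th powers. -/
theorem sum_perm_prod_mem_linSpan (φ : ZMod p →+* k) {y : Fin p → U} (hy : ∀ i, y i ∈ A) :
    ∑ σ : Equiv.Perm (Fin p), (List.ofFn fun i => y (σ i)).prod ∈ linSpan A p := by
  classical
  have h := Finset.inclusion_exclusion_sum_inf_compl (Finset.univ : Finset (Fin p))
    (fun i => ({i}ᶜ : Finset (Fin p))) (fun i => y i ^ p)
  have hinf : ∀ t : Finset (Fin p), (t.inf fun i => ({i}ᶜ : Finset (Fin p))) = tᶜ := by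
    intro t
    ext r
    simp only [Finset.mem_inf, Finset.mem_compl, Finset.mem_singleton]
    exact ⟨fun h hr => h r hr rfl, fun h i hi hr => h (hr ▸ hi)⟩
  have hempty : (Finset.univ.inf fun i => (({i}ᶜ : Finset (Fin p)))ᶜ) = ∅ := by
    have : Nontrivial (Fin p) := Fin.nontrivial_iff_two_le.mpr hp.out.two_le
    ext r
    simp only [compl_compl, Finset.mem_inf, Finset.mem_singleton, Finset.notMem_empty, iff_false,
      not_forall]
    obtain ⟨s, hs⟩ := exists_ne r
    exact ⟨s, Finset.mem_univ s, hs.symm⟩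
  simp only [hinf, hempty, Finset.sum_empty] at h
  rw [sum_perm_prod_eq, ← sub_zero (Finset.sum _ _), h, ← Finset.sum_sub_distrib]
  refine sum_mem fun t _ => ?_
  rw [← smul_sub]
  exact zsmul_mem (sum_pow_sub_mem_linSpan φ hy _) _

end Symmetrization

section Transfer

variable {k : Type*} [Field k]

theorem map_lprod {B R : Type*} [NonUnitalSemiring B] [Semiring R] (f : B →ₙ+* R) {l : List B}
    (hl : l ≠ []) : f (lprod l) = (l.map f).prod := by
  induction l with
  | nil => exact absurd rfl hl
  | cons a l ih =>
    cases l with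
    | nil => simp [lprod]
    | cons b l => simp only [lprod, map_mul, ih (List.cons_ne_nil b l), List.map_cons,
        List.prod_cons]

theorem map_npow' {B R : Type*} [NonUnitalSemiring B] [Semiring R] (f : B →ₙ+* R) (a : B)
    {n : ℕ} (hn : n ≠ 0) : f (npow' a n) = f a ^ n := by
  rw [npow', map_lprod f (by simpa using hn), List.map_replicate, List.prod_replicate]

theorem map_Ssym {B R : Type*} [NonUnitalSemiring B] [Semiring R] (f : B →ₙ+* R) {n : ℕ}
    (hn : n ≠ 0) (y : Fin n → B) :
    f (Ssym n y) = ∑ σ : Equiv.Perm (Fin n), (List.ofFn fun i => f (y (σ i))).prod := by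
  rw [Ssym, map_sum]
  refine Finset.sum_congr rfl fun σ _ => ?_
  rw [map_lprod f (by simpa using hn), List.map_ofFn]
  rfl

theorem isTSpace_TSpan (T : Set (FA k)) : IsTSpace k (TSpan k T) := by
  intro φ v hv
  suffices h : TSpan k T ≤ (TSpan k T).comap (φ : FA k →ₗ[k] FA k) from h hv
  refine Submodule.span_le.mpr ?_
  rintro _ ⟨ψ, s, hs, rfl⟩
  exact Submodule.subset_span ⟨φ.comp ψ, s, hs, rfl⟩

theorem subset_TSpan (T : Set (FA k)) : T ⊆ TSpan k T := fun s hs =>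
  Submodule.subset_span ⟨NonUnitalAlgHom.id k (FA k), s, hs, rfl⟩

theorem Hn_one (p : ℕ) : Hn k p 1 = TSpan k {npow' (Xg k 0) p} := by rw [Hn]

theorem Hn_add_two (p n : ℕ) :
    Hn k p (n + 2) = TSpan k (mulSet (Hn k p (n + 1)) (Hn k p 1)) := by
  conv_lhs => rw [Hn]

theorem Sn_one (d : ℕ) : Sn k d 1 = TSpan k {Ssym d fun i => Xg k i} := by rw [Sn]

theorem isTSpace_Hn (p n : ℕ) : IsTSpace k (Hn k p (n + 1)) := by
  cases n with
  | zero => rw [zero_add, Hn_one]; exact isTSpace_TSpan _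
  | succ n => rw [Hn_add_two]; exact isTSpace_TSpan _

theorem exists_map_Xg (f : ℕ → FA k) : ∃ φ : FA k →ₙₐ[k] FA k, ∀ i, φ (Xg k i) = f i :=
  ⟨MonoidAlgebra.liftMagma k (FreeSemigroup.lift f), fun i => by simp [Xg]⟩

variable (k) in
/-- The free non-unital algebra, as a subalgebra of its unitization. -/
noncomputable def freePart : NonUnitalSubalgebra k (Unitization k (FA k)) :=
  NonUnitalAlgHom.range (Unitization.inrNonUnitalAlgHom k (FA k))

theorem inr_mem_freePart (a : FA k) : (a : Unitization k (FA k)) ∈ freePart k := ⟨a, rfl⟩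

theorem inr_map_npow' (φ : FA k →ₙₐ[k] FA k) (a : FA k) {n : ℕ} (hn : n ≠ 0) :
    ((φ (npow' a n) : FA k) : Unitization k (FA k)) = (φ a : Unitization k (FA k)) ^ n :=
  map_npow' (((Unitization.inrNonUnitalAlgHom k (FA k)).comp φ : FA k →ₙₐ[k] _) :
    FA k →ₙ+* Unitization k (FA k)) a hn

theorem inr_map_Ssym (φ : FA k →ₙₐ[k] FA k) {n : ℕ} (hn : n ≠ 0) (y : Fin n → FA k) :
    ((φ (Ssym n y) : FA k) : Unitization k (FA k)) =
      ∑ σ : Equiv.Perm (Fin n),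
        (List.ofFn fun i => (φ (y (σ i)) : Unitization k (FA k))).prod :=
  map_Ssym (((Unitization.inrNonUnitalAlgHom k (FA k)).comp φ : FA k →ₙₐ[k] _) :
    FA k →ₙ+* Unitization k (FA k)) hn y

theorem inr_mem_powSpan {p : ℕ} (hp : p ≠ 0) {u : FA k} (hu : u ∈ Hn k p 1) :
    (u : Unitization k (FA k)) ∈ powSpan (freePart k) p := by
  suffices h : Hn k p 1 ≤ (powSpan (freePart k) p).comap (Unitization.inrHom k k (FA k)) from h hu
  rw [Hn_one]
  refine Submodule.span_le.mpr ?_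
  rintro _ ⟨φ, _, rfl, rfl⟩
  change ((φ (npow' (Xg k 0) p) : FA k) : Unitization k (FA k)) ∈ powSpan (freePart k) p
  rw [inr_map_npow' φ _ hp]
  exact pow_mem_powSpan (inr_mem_freePart _)

theorem inr_mem_powSpan_pow {p : ℕ} (hp : p ≠ 0) {n : ℕ} {u : FA k}
    (hu : u ∈ Hn k p (n + 1)) :
    (u : Unitization k (FA k)) ∈ powSpan (freePart k) p ^ (n + 1) := by
  induction n generalizing u with
  | zero =>
    rw [zero_add, pow_one]
    exact inr_mem_powSpan hp hu
  | succ n ih =>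
    suffices h : Hn k p (n + 2) ≤ (powSpan (freePart k) p ^ (n + 2)).comap
      (Unitization.inrHom k k (FA k)) from h hu
    rw [Hn_add_two]
    refine Submodule.span_le.mpr ?_
    rintro _ ⟨φ, _, ⟨a, ha, b, hb, rfl⟩, rfl⟩
    change ((φ (a * b) : FA k) : Unitization k (FA k)) ∈ powSpan (freePart k) p ^ (n + 2)
    rw [map_mul, Unitization.inr_mul, pow_succ]
    exact Submodule.mul_mem_mul (ih (isTSpace_Hn p n φ a ha))
      (inr_mem_powSpan hp (isTSpace_Hn p 0 φ b hb))

theorem powSpan_le_map {p : ℕ} (hp : p ≠ 0) :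
    powSpan (freePart k) p ≤ (Hn k p 1).map (Unitization.inrHom k k (FA k)) := by
  refine Submodule.span_le.mpr ?_
  rintro _ ⟨_, ⟨b, rfl⟩, rfl⟩
  obtain ⟨φ, hφ⟩ := exists_map_Xg fun _ => b
  refine ⟨φ (npow' (Xg k 0) p), ?_, ?_⟩
  · rw [Hn_one]
    exact Submodule.subset_span ⟨φ, _, rfl, rfl⟩
  change ((φ (npow' (Xg k 0) p) : FA k) : Unitization k (FA k)) = _
  rw [inr_map_npow' φ _ hp, hφ]
  rfl

theorem powSpan_pow_le_map {p : ℕ} (hp : p ≠ 0) (n : ℕ) :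
    powSpan (freePart k) p ^ (n + 1) ≤
      (Hn k p (n + 1)).map (Unitization.inrHom k k (FA k)) := by
  induction n with
  | zero =>
    rw [zero_add, pow_one]
    exact powSpan_le_map hp
  | succ n ih =>
    rw [pow_succ, Submodule.mul_le]
    intro a ha b hb
    obtain ⟨a, ha', rfl⟩ := ih ha
    obtain ⟨b, hb', rfl⟩ := powSpan_le_map hp hb
    refine ⟨a * b, ?_, Unitization.inr_mul k a b⟩
    rw [Hn_add_two]
    exact subset_TSpan _ ⟨a, ha', b, hb', rfl⟩

theorem inr_mem_linSpan {p : ℕ} [hp : Fact p.Prime] (θ : ZMod p →+* k) {s : FA k}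
    (hs : s ∈ Sn k p 1) : (s : Unitization k (FA k)) ∈ linSpan (freePart k) p := by
  suffices h : Sn k p 1 ≤ (linSpan (freePart k) p).comap
      (Unitization.inrHom k k (FA k)) from h hs
  rw [Sn_one]
  refine Submodule.span_le.mpr ?_
  rintro _ ⟨φ, _, rfl, rfl⟩
  change ((φ (Ssym p fun i => Xg k i) : FA k) : Unitization k (FA k)) ∈ linSpan (freePart k) p
  rw [inr_map_Ssym φ hp.out.ne_zero]
  exact sum_perm_prod_mem_linSpan θ (y := fun i => (φ (Xg k i) : Unitization k (FA k)))
    fun i => inr_mem_freePart _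

end Transfer

/-- For `1 ≤ i ≤ 2m-1`, `H_i S^{(p)} H_{2m-i} ⊆ H_1 + H_{m+1}`: every product `u s w`
with `u ∈ H_i`, `s ∈ S_1^{(p)}`, `w ∈ H_{2m-i}` lies in `H_1 + H_{m+1}`. -/
theorem fundamental_h_result (k : Type*) [Field k] (p : ℕ) (hp : p.Prime) [CharP k p] :
    ∀ m : ℕ, 1 ≤ m → ∀ i : ℕ, 1 ≤ i → i ≤ 2 * m - 1 →
      ∀ u ∈ Hn k p i, ∀ s ∈ Sn k p 1, ∀ w ∈ Hn k p (2 * m - i),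
        u * s * w ∈ Hn k p 1 ⊔ Hn k p (m + 1) := by
  intro m hm i hi him u hu s hs w hw
  have : Fact p.Prime := ⟨hp⟩
  obtain ⟨a, rfl⟩ : ∃ a, i = a + 1 := ⟨i - 1, by omega⟩
  obtain ⟨b, hb⟩ : ∃ b, 2 * m - (a + 1) = b + 1 := ⟨2 * m - (a + 1) - 1, by omega⟩
  rw [hb] at hw
  have θ : ZMod p →+* k := ZMod.castHom (dvd_refl p) k
  have h := mul_linSpan_mul_mem θ hm (by omega : m ≤ a + 1 + (b + 1))
    (inr_mem_powSpan_pow hp.ne_zero hu) (inr_mem_linSpan θ hs)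
    (inr_mem_powSpan_pow hp.ne_zero hw)
  have hle : powSpan (freePart k) p ⊔ powSpan (freePart k) p ^ (m + 1) ≤
      (Hn k p 1 ⊔ Hn k p (m + 1)).map (Unitization.inrHom k k (FA k)) := by
    rw [Submodule.map_sup]
    exact sup_le_sup (powSpan_le_map hp.ne_zero) (powSpan_pow_le_map hp.ne_zero m)
  rw [← Unitization.inr_mul, ← Unitization.inr_mul] at h
  obtain ⟨z, hz, hzu⟩ := hle h
  rwa [← Unitization.inr_injective hzu]
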